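/- Let X be a shift space with language 𝓛 = 𝓛(X) and suppose 𝓖 ⊂ 𝓛 has (W)-specification and 𝓛 is edit approachable by 𝓖. For a continuous function ψ : X → ℝ, the multifractal spectrum 𝓛_ψ := {α ∈ ℝ : X(ψ,α) ≠ ∅} is a non-empty bounded interval, and moreover 𝓛_ψ = {∫ ψ dμ : μ ∈ M_σ(X)}. -/

import Mathlib

open MeasureTheory Filter Topology Set
open scoped ENNReal Classical

namespace Paper

variable {A : Type} [Fintype A] [DecidableEq A] [TopologicalSpace A] [DiscreteTopology A]
  [MeasurableSpace A] [BorelSpace A]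

/-- The left shift map on the full shift `A^ℕ`. -/
def shift : (ℕ → A) → (ℕ → A) := fun x i => x (i + 1)

/-- The cylinder set of a finite word `w`: points whose initial word is `w`. -/
def cylinder (w : List A) : Set (ℕ → A) := {x | ∀ i : Fin w.length, x i = w.get i}

/-- The language of `X`: finite words `w` with `[w] ∩ X ≠ ∅`. -/
def language (X : Set (ℕ → A)) : Set (List A) := {w | (cylinder w ∩ X).Nonempty}

/-- One edit of a word: a substitution, an insertion, or a deletion. -/
def EditStep (w w' : List A) : Prop :=
  (∃ u₁ u₂ : List A, ∃ a a' : A, w = u₁ ++ [a] ++ u₂ ∧ w' = u₁ ++ [a'] ++ u₂) ∨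
  (∃ u₁ u₂ : List A, ∃ a' : A, w = u₁ ++ u₂ ∧ w' = u₁ ++ [a'] ++ u₂) ∨
  (∃ u₁ u₂ : List A, ∃ a : A, w = u₁ ++ [a] ++ u₂ ∧ w' = u₁ ++ u₂)

/-- The edit distance: the minimal number of edits transforming `v` into `w`. -/
noncomputable def editDist (v w : List A) : ℕ :=
  sInf {n | ∃ f : ℕ → List A, f 0 = v ∧ f n = w ∧ ∀ i < n, EditStep (f i) (f (i + 1))}

/-- `G ⊆ L` has (W)-specification (with some gap length `τ`). -/
def HasSpecW (L G : Set (List A)) : Prop :=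
  ∃ τ : ℕ, ∀ v ∈ G, ∀ w ∈ G, ∃ u ∈ L, u.length ≤ τ ∧ v ++ u ++ w ∈ G

/-- A mistake function: nondecreasing with `g n / n → 0`. -/
def MistakeFun (g : ℕ → ℕ) : Prop :=
  Monotone g ∧ Tendsto (fun n => (g n : ℝ) / n) atTop (𝓝 0)

/-- `L` is edit approachable by `G`. -/
def EditApproachable (L G : Set (List A)) : Prop :=
  ∃ g : ℕ → ℕ, MistakeFun g ∧ ∀ w ∈ L, ∃ v ∈ G, editDist v w ≤ g w.length

/-- The shift map restricted to a (shift-invariant) subset `X`, as a self-map of `↥X`. -/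
noncomputable def subShift (X : Set (ℕ → A)) : ↥X → ↥X := fun x =>
  if h : shift x.val ∈ X then ⟨shift x.val, h⟩ else x

/-- Birkhoff sum `S_n φ = ∑_{i<n} φ ∘ σ^i`. -/
def birkhoff {Y : Type*} (σ : Y → Y) (φ : Y → ℝ) (n : ℕ) (y : Y) : ℝ :=
  ∑ i ∈ Finset.range n, φ (σ^[i] y)

/-- The Birkhoff average `(1/n) S_n φ`. -/
noncomputable def birkAvg {Y : Type*} (σ : Y → Y) (φ : Y → ℝ) (n : ℕ) (y : Y) : ℝ :=
  (n : ℝ)⁻¹ * birkhoff σ φ n y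

/-- Carathéodory sum `M(Z,t,φ,N)` over covers of `Z` by cylinders of length `> N`. -/
noncomputable def Mcal (X : Set (ℕ → A)) (φ : ↥X → ℝ) (Z : Set ↥X) (t : ℝ) (N : ℕ) : ℝ≥0∞ :=
  ⨅ (S : Set (List A)) (_ : S.Countable) (_ : ∀ w ∈ S, N < w.length)
    (_ : Z ⊆ ⋃ w ∈ S, Subtype.val ⁻¹' cylinder w),
    ∑' w : S, ENNReal.ofReal (Real.exp (-t * (w : List A).length +
      sSup (birkhoff (subShift X) φ (w : List A).length ''
        (Subtype.val ⁻¹' cylinder (w : List A)))))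

/-- `M(Z,t,φ) = lim_{N→∞} M(Z,t,φ,N)` (the limit of a nondecreasing quantity). -/
noncomputable def McalLim (X : Set (ℕ → A)) (φ : ↥X → ℝ) (Z : Set ↥X) (t : ℝ) : ℝ≥0∞ :=
  ⨆ N : ℕ, Mcal X φ Z t N

/-- The topological pressure `P_Z(φ)` of `Z ⊆ X`. -/
noncomputable def pressure (X : Set (ℕ → A)) (φ : ↥X → ℝ) (Z : Set ↥X) : ℝ :=
  sInf {t : ℝ | McalLim X φ Z t = 0}

/-- The empirical measure `ℰ_n(x) = (1/n) ∑_{i<n} δ_{σ^i x}`. -/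
noncomputable def empiric {Y : Type*} [MeasurableSpace Y] (σ : Y → Y) (n : ℕ) (x : Y) :
    Measure Y := (n : ℝ≥0∞)⁻¹ • ∑ i ∈ Finset.range n, Measure.dirac (σ^[i] x)

/-- The set `A(ℰ_n(x))` of weak* limit points of the sequence of empirical measures of `x`:
probability measures that are limits of the empirical measures along a subsequence. -/
def limitPts {Y : Type*} [MeasurableSpace Y] [TopologicalSpace Y] (σ : Y → Y) (x : Y) :
    Set (ProbabilityMeasure Y) :=
  {μ | ∃ φ : ℕ → ℕ, StrictMono φ ∧ ∀ f : C(Y, ℝ),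
      Tendsto (fun k => birkAvg σ (fun y => f y) (φ k) x) atTop (𝓝 (∫ y, f y ∂μ.toMeasure))}

/-- The saturated set `G_K = {x : A(ℰ_n(x)) = K}`. -/
def saturated {Y : Type*} [MeasurableSpace Y] [TopologicalSpace Y] (σ : Y → Y)
    (K : Set (ProbabilityMeasure Y)) : Set Y := {x | limitPts σ x = K}

/-- The generic points of `μ`: those `x` with `ℰ_n(x) → μ` in the weak* topology. -/
def genericPts {Y : Type*} [MeasurableSpace Y] [TopologicalSpace Y] (σ : Y → Y)
    (μ : ProbabilityMeasure Y) : Set Y :=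
  {x | ∀ f : C(Y, ℝ),
      Tendsto (fun n => birkAvg σ (fun y => f y) n x) atTop (𝓝 (∫ y, f y ∂μ.toMeasure))}

/-- `μ` is a `σ`-invariant (probability) measure. -/
def IsInvariant {Y : Type*} [MeasurableSpace Y] (σ : Y → Y) (μ : ProbabilityMeasure Y) : Prop :=
  μ.toMeasure.map σ = μ.toMeasure

/-- The level set `X(ψ,α)` of points whose Birkhoff averages of `ψ` converge to `α`. -/
def levelSet {Y : Type*} (σ : Y → Y) (ψ : Y → ℝ) (α : ℝ) : Set Y :=
  {x | Tendsto (fun n => birkAvg σ ψ n x) atTop (𝓝 α)}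

/-- The irregular set `X̂(ψ)` of points whose Birkhoff averages of `ψ` do not converge. -/
def irregular {Y : Type*} (σ : Y → Y) (ψ : Y → ℝ) : Set Y :=
  {x | ¬ ∃ α : ℝ, Tendsto (fun n => birkAvg σ ψ n x) atTop (𝓝 α)}

/-- The cylinder of a word of length `n` given as `w : Fin n → A`. -/
def cylF {n : ℕ} (w : Fin n → A) : Set (ℕ → A) := {x | ∀ i : Fin n, x i = w i}

/-- The entropy `H_n(μ)` of the partition of `X` into cylinders of length `n`. -/
noncomputable def wordEntropy (X : Set (ℕ → A)) (μ : ProbabilityMeasure ↥X) (n : ℕ) : ℝ :=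
  ∑ w : Fin n → A, Real.negMulLog ((μ.toMeasure (Subtype.val ⁻¹' cylF w)).toReal)

/-- The measure-theoretic (Kolmogorov–Sinai) entropy `h_μ(σ)` of a shift-invariant measure on a
subshift: by subadditivity, `lim_n H_n/n = inf_{n ≥ 1} H_n/n`. -/
noncomputable def entropy (X : Set (ℕ → A)) (μ : ProbabilityMeasure ↥X) : ℝ :=
  ⨅ n : ℕ, wordEntropy X μ (n + 1) / (n + 1)

/-- The distance `D` on measures induced by a countable family of continuous functions. -/
noncomputable def Dmetric {Y : Type*} [MeasurableSpace Y] [TopologicalSpace Y]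
    (f : ℕ → C(Y, ℝ)) (μ ν : Measure Y) : ℝ :=
  ∑' k : ℕ, ((2 : ℝ) ^ (k + 1))⁻¹ * |(∫ y, f k y ∂μ) - ∫ y, f k y ∂ν|

/-- The family `f` is separating: `D` separates Borel probability measures. -/
def Separating {Y : Type*} [MeasurableSpace Y] [TopologicalSpace Y] (f : ℕ → C(Y, ℝ)) : Prop :=
  ∀ μ ν : ProbabilityMeasure Y,
    (∀ k, (∫ y, f k y ∂μ.toMeasure) = ∫ y, f k y ∂ν.toMeasure) → μ = ν

/-- Diameter of a set with respect to a distance function `d`, valued in `ℝ≥0∞`. -/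
noncomputable def ediam {Y : Type*} (d : Y → Y → ℝ) (U : Set Y) : ℝ≥0∞ :=
  ⨆ x ∈ U, ⨆ y ∈ U, ENNReal.ofReal (d x y)

/-- The `s`-dimensional Hausdorff pre-measure at scale `ε` w.r.t. the distance `d`. -/
noncomputable def hMeasAux {Y : Type*} (d : Y → Y → ℝ) (s : ℝ) (ε : ℝ≥0∞) (Z : Set Y) : ℝ≥0∞ :=
  ⨅ (C : ℕ → Set Y) (_ : Z ⊆ ⋃ n, C n) (_ : ∀ n, ediam d (C n) ≤ ε),
    ∑' n, ⨆ (_ : (C n).Nonempty), ediam d (C n) ^ s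

/-- The `s`-dimensional Hausdorff measure w.r.t. the distance `d`. -/
noncomputable def hMeas {Y : Type*} (d : Y → Y → ℝ) (s : ℝ) (Z : Set Y) : ℝ≥0∞ :=
  ⨆ (ε : ℝ≥0∞) (_ : 0 < ε), hMeasAux d s ε Z

/-- The Hausdorff dimension of `Z` w.r.t. the distance `d`. -/
noncomputable def hdim {Y : Type*} (d : Y → Y → ℝ) (Z : Set Y) : ℝ :=
  sInf {s : ℝ | 0 ≤ s ∧ hMeas d s Z = 0}

/-- The length `|x ∧ y|` of the longest common prefix of two distinct points. -/
noncomputable def wedge (x y : ℕ → A) : ℕ := sInf {n | x n ≠ y n}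

/-- The Gatzouras–Peres distance `d_φ` associated with a strictly positive continuous `φ`. -/
noncomputable def dphi (X : Set (ℕ → A)) (φ : ↥X → ℝ) (x y : ↥X) : ℝ :=
  if x = y then 0
  else Real.exp (-(sSup (birkhoff (subShift X) φ (wedge x.val y.val) ''
      {z : ↥X | ∀ i < wedge x.val y.val, z.val i = x.val i})))

/-- The word `w` occurs in `x` at position `k`. -/
def occursAt (w : List A) (x : ℕ → A) (k : ℕ) : Prop :=
  ∀ i : Fin w.length, x (k + i) = w.get i

/-- A shift of finite type: determined by a finite set of forbidden words. -/
def IsSFT {B : Type} (Z : Set (ℕ → B)) : Prop :=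
  ∃ F : Set (List B), F.Finite ∧ Z = {x | ∀ w ∈ F, ∀ k, ¬ occursAt w x k}

/-- A sofic shift: the image of a shift of finite type under a sliding block code. -/
def IsSofic (Y : Set (ℕ → A)) : Prop :=
  ∃ (B : Type) (_ : Fintype B) (Z : Set (ℕ → B)) (π : (ℕ → B) → (ℕ → A)),
    IsSFT Z ∧ Set.MapsTo shift Z Z ∧
    (∃ r : ℕ, ∀ z ∈ Z, ∀ z' ∈ Z, ∀ k, (∀ i ≤ k + r, z i = z' i) → π z k = π z' k) ∧
    (∀ z ∈ Z, π (shift z) = shift (π z)) ∧ π '' Z = Y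

/-- Topological transitivity of a subshift, via its language. -/
def IsTransitive (Y : Set (ℕ → A)) : Prop :=
  ∀ u ∈ language Y, ∀ v ∈ language Y, ∃ w : List A, u ++ w ++ v ∈ language Y

/-- The prefix of length `n` of `x`, as a word. -/
def prefixWord (x : ℕ → A) (n : ℕ) : List A := List.ofFn fun i : Fin n => x i

/-- The norm `‖m‖ = sup_{0 < ‖f‖ ≤ 1} |∫ f dm| / ‖f‖` of a measure on a compact space. -/
noncomputable def mnorm {Y : Type*} [TopologicalSpace Y] [CompactSpace Y] [MeasurableSpace Y]
    (m : Measure Y) : ℝ :=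
  sSup ((fun f : C(Y, ℝ) => |∫ y, f y ∂m| / ‖f‖) '' {f : C(Y, ℝ) | 0 < ‖f‖ ∧ ‖f‖ ≤ 1})

/-- Strict lexicographic order on `ℕ`-indexed sequences of naturals. -/
def lexLt (x y : ℕ → ℕ) : Prop := ∃ n : ℕ, (∀ i < n, x i = y i) ∧ x n < y n

/-- The β-shift: all sequences over `{0, …, b-1}` all of whose shifts are lexicographically
below the expansion `w` of `1` in base `β` (where `b = ⌈β⌉`). -/
def betaShift (b : ℕ) (w : ℕ → ℕ) : Set (ℕ → Fin b) :=
  {x | ∀ j : ℕ, 1 ≤ j → lexLt (fun i => ((shift^[j] x) i : ℕ)) w}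

/-- The S-gap shift: sequences over `{0,1}` such that the number of `0`s between any two
consecutive `1`s lies in `S`. -/
def sGapShift (S : Set ℕ) : Set (ℕ → Fin 2) :=
  {x | ∀ k l : ℕ, k < l → x k = 1 → x l = 1 →
    (∀ m : ℕ, k < m → m < l → x m = 0) → l - k - 1 ∈ S}


section InvariantMeasure

lemma isProbabilityMeasure_empiric {Y : Type*} [MeasurableSpace Y] (σ : Y → Y) {n : ℕ}
    (hn : n ≠ 0) (x : Y) : IsProbabilityMeasure (empiric σ n x) := by
  constructor
  simp only [empiric, Measure.smul_apply, Measure.finsetSum_apply, measure_univ,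
    Finset.sum_const, Finset.card_range, smul_eq_mul, nsmul_eq_mul, mul_one]
  exact ENNReal.inv_mul_cancel (by exact_mod_cast hn) (ENNReal.natCast_ne_top n)

lemma integral_empiric {Y : Type*} [MeasurableSpace Y] (σ : Y → Y) (n : ℕ) (x : Y) {f : Y → ℝ}
    (hf : StronglyMeasurable f) : ∫ y, f y ∂(empiric σ n x) = birkAvg σ f n x := by
  unfold empiric birkAvg birkhoff
  rw [integral_smul_measure, integral_finsetSum_measure]
  · simp [integral_dirac' _ _ hf]
  · intro i _
    exact integrable_dirac' hf (by simp)

lemma birkhoff_succ {Y : Type*} (σ : Y → Y) (φ : Y → ℝ) (n : ℕ) (y : Y) :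
    birkhoff σ φ (n + 1) y = φ y + birkhoff σ φ n (σ y) := by
  simp only [birkhoff, Finset.sum_range_succ', Function.iterate_succ_apply,
    Function.iterate_zero, id_eq]
  ring

lemma birkhoff_succ_last {Y : Type*} (σ : Y → Y) (φ : Y → ℝ) (n : ℕ) (y : Y) :
    birkhoff σ φ (n + 1) y = birkhoff σ φ n y + φ (σ^[n] y) :=
  Finset.sum_range_succ _ _

lemma birkhoff_comp {Y : Type*} (σ : Y → Y) (φ : Y → ℝ) (n : ℕ) (y : Y) :
    birkhoff σ (φ ∘ σ) n y = birkhoff σ φ n (σ y) := by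
  simp only [birkhoff, Function.comp, ← Function.iterate_succ_apply' σ,
    ← Function.iterate_succ_apply σ]

lemma tendsto_birkAvg_comp_sub {Y : Type*} (σ : Y → Y) {φ : Y → ℝ} {M : ℝ}
    (hM : ∀ y, |φ y| ≤ M) (x : Y) :
    Tendsto (fun n => birkAvg σ (φ ∘ σ) n x - birkAvg σ φ n x) atTop (𝓝 0) := by
  have hlim : Tendsto (fun n : ℕ => (n : ℝ)⁻¹ * (2 * M)) atTop (𝓝 0) := by
    simpa using tendsto_inv_atTop_nhds_zero_nat.mul_const (2 * M)
  refine squeeze_zero_norm (fun n => ?_) hlim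
  have h1 := birkhoff_succ σ φ n x
  rw [birkhoff_succ_last] at h1
  rw [Real.norm_eq_abs, birkAvg, birkAvg, birkhoff_comp, ← mul_sub, abs_mul,
    abs_of_nonneg (by positivity : (0 : ℝ) ≤ (n : ℝ)⁻¹)]
  refine mul_le_mul_of_nonneg_left ?_ (by positivity)
  have h2 := abs_le.1 (hM x)
  have h3 := abs_le.1 (hM (σ^[n] x))
  rw [abs_le]
  constructor <;> linarith

/-- Krylov–Bogolyubov: along the orbit of `x` one finds an invariant measure which computes every
limit of Birkhoff averages of `ψ`. -/
lemma exists_isInvariant_integral_eq {Y : Type*} [TopologicalSpace Y] [CompactSpace Y]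
    [TopologicalSpace.MetrizableSpace Y] [MeasurableSpace Y] [BorelSpace Y] {σ : Y → Y}
    (hσ : Continuous σ) {ψ : Y → ℝ} (hψ : Continuous ψ) (x : Y) :
    ∃ μ : ProbabilityMeasure Y, IsInvariant σ μ ∧
      ∀ α, Tendsto (fun n => birkAvg σ ψ n x) atTop (𝓝 α) → ∫ y, ψ y ∂μ.toMeasure = α := by
  let e : ℕ → ProbabilityMeasure Y := fun n =>
    ⟨empiric σ (n + 1) x, isProbabilityMeasure_empiric σ n.succ_ne_zero x⟩
  obtain ⟨μ, -, hμ⟩ := isCompact_univ.ultrafilter_le_nhds ((hyperfilter ℕ).map e) (by simp)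
  have hμ' : Tendsto e (hyperfilter ℕ) (𝓝 μ) := hμ
  have hle : (hyperfilter ℕ : Filter ℕ) ≤ atTop := by
    rw [← Nat.cofinite_eq_atTop]; exact hyperfilter_le_cofinite
  have hlim : ∀ f : Y → ℝ, Continuous f →
      Tendsto (fun n => birkAvg σ f (n + 1) x) (hyperfilter ℕ) (𝓝 (∫ y, f y ∂μ.toMeasure)) := by
    intro f hf
    have := (ProbabilityMeasure.tendsto_iff_forall_integral_tendsto.1 hμ')
      (BoundedContinuousFunction.mkOfCompact ⟨f, hf⟩)
    refine this.congr fun n => ?_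
    exact integral_empiric σ (n + 1) x hf.stronglyMeasurable
  refine ⟨μ, ?_, fun α hα => ?_⟩
  · have : IsProbabilityMeasure (μ.toMeasure.map σ) :=
      Measure.isProbabilityMeasure_map hσ.measurable.aemeasurable
    refine ext_of_forall_integral_eq_of_IsFiniteMeasure fun f => ?_
    rw [integral_map hσ.measurable.aemeasurable
      f.continuous.stronglyMeasurable.aestronglyMeasurable]
    have h := ((tendsto_add_atTop_iff_nat 1).2
      (tendsto_birkAvg_comp_sub σ (fun y => f.norm_coe_le_norm y) x)).mono_left hle
    have h' := (hlim _ (f.continuous.comp hσ)).sub (hlim _ f.continuous)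
    exact sub_eq_zero.1 (tendsto_nhds_unique h' h)
  · exact tendsto_nhds_unique (hlim ψ hψ) (((tendsto_add_atTop_iff_nat 1).2 hα).mono_left hle)

lemma integral_birkhoff {Y : Type*} [MeasurableSpace Y] {σ : Y → Y} (hσ : Measurable σ)
    {μ : ProbabilityMeasure Y} (hμ : IsInvariant σ μ) {ψ : Y → ℝ} (hψ : Integrable ψ μ.toMeasure)
    (n : ℕ) : Integrable (birkhoff σ ψ n) μ.toMeasure ∧
      ∫ y, birkhoff σ ψ n y ∂μ.toMeasure = n * ∫ y, ψ y ∂μ.toMeasure := by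
  have hmp : MeasurePreserving σ μ.toMeasure μ.toMeasure := ⟨hσ, hμ⟩
  have hint : ∀ i, Integrable (fun y => ψ (σ^[i] y)) μ.toMeasure := fun i =>
    (hmp.iterate i).integrable_comp_of_integrable hψ
  have heq : ∀ i, ∫ y, ψ (σ^[i] y) ∂μ.toMeasure = ∫ y, ψ y ∂μ.toMeasure := fun i => by
    have h := (hmp.iterate i).map_eq
    conv_rhs => rw [← h]
    rw [integral_map (hmp.iterate i).measurable.aemeasurable (by rw [h]; exact hψ.1)]
  unfold birkhoff
  refine ⟨integrable_finsetSum _ fun i _ => hint i, ?_⟩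
  rw [integral_finsetSum _ fun i _ => hint i]
  simp [heq]

end InvariantMeasure

section Drift

/-- A sequence which is bounded by `ε ℓ` or increases by at most `ε` times the increment of `ℓ`
is eventually bounded by `2 ε ℓ`. -/
lemma eventually_le_of_drift {t ℓ : ℕ → ℝ} {ε : ℝ} (hε : 0 < ε) (hℓ : Tendsto ℓ atTop atTop)
    (h : ∀ᶠ j in atTop, t (j + 1) ≤ t j + ε * (ℓ (j + 1) - ℓ j) ∨ t (j + 1) ≤ ε * ℓ (j + 1)) :
    ∀ᶠ j in atTop, t j ≤ 2 * ε * ℓ j := by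
  obtain ⟨J, hJ⟩ := eventually_atTop.1 h
  set B := max (t J - ε * ℓ J) 0 with hB
  have key : ∀ j ≥ J, t j ≤ ε * ℓ j + B := by
    intro j hj
    induction j, hj using Nat.le_induction with
    | base => linarith [le_max_left (t J - ε * ℓ J) 0]
    | succ j hj ih =>
      rcases hJ j hj with h | h
      · linarith
      · linarith [le_max_right (t J - ε * ℓ J) 0]
  filter_upwards [eventually_ge_atTop J, hℓ.eventually_ge_atTop (B / ε)] with j hj hj'
  have := key j hj
  rw [div_le_iff₀ hε] at hj'
  linarith

lemma eventually_mul_le_of_increment {ℓ : ℕ → ℝ}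
    (h : ∀ᶠ j : ℕ in atTop, ℓ j + j / 2 ≤ ℓ (j + 1)) (K : ℝ) :
    ∀ᶠ j : ℕ in atTop, K * j ≤ ℓ j := by
  have hℓ : Tendsto ℓ atTop atTop := by
    obtain ⟨J, hJ⟩ := eventually_atTop.1 (h.and (eventually_ge_atTop 2))
    have key : ∀ j ≥ J, ℓ J + (j - J : ℝ) ≤ ℓ j := by
      intro j hj
      induction j, hj using Nat.le_induction with
      | base => simp
      | succ j hj ih =>
        obtain ⟨h1, h2⟩ := hJ j hj
        have : (2 : ℝ) ≤ j := by exact_mod_cast h2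
        push_cast
        linarith
    have hlin : Tendsto (fun j : ℕ => (j : ℝ) + (ℓ J - J)) atTop atTop :=
      tendsto_atTop_add_const_right _ _ tendsto_natCast_atTop_atTop
    refine tendsto_atTop_mono' _ ?_ hlin
    filter_upwards [eventually_ge_atTop J] with j hj
    linarith [key j hj]
  have := eventually_le_of_drift (t := fun j : ℕ => K * j) (ε := 1 / 2) (by norm_num) hℓ ?_
  · filter_upwards [this] with j hj
    linarith
  · filter_upwards [h, tendsto_natCast_atTop_atTop.eventually_ge_atTop (4 * K)] with j h1 h2
    left
    push_cast
    linarith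

lemma eventually_of_blocks {ℓ : ℕ → ℕ} {Q : ℕ → Prop} (hℓ : Tendsto ℓ atTop atTop)
    (h : ∀ᶠ j in atTop, ∀ n, ℓ j ≤ n → n ≤ ℓ (j + 1) → Q n) : ∀ᶠ n in atTop, Q n := by
  obtain ⟨J, hJ⟩ := eventually_atTop.1 h
  filter_upwards [eventually_gt_atTop (ℓ J)] with n hn
  have hex : ∃ i, n ≤ ℓ (J + i) := by
    obtain ⟨j, h1, h2⟩ := ((hℓ.eventually_ge_atTop n).and (eventually_ge_atTop J)).exists
    exact ⟨j - J, by rwa [Nat.add_sub_cancel' h2]⟩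
  by_cases hz : Nat.find hex = 0
  · have := Nat.find_spec hex
    rw [hz] at this
    exact absurd hn (not_lt.2 this)
  · obtain ⟨i, hi⟩ := Nat.exists_eq_succ_of_ne_zero hz
    have h1 := Nat.find_spec hex
    have h2 := Nat.find_min hex (m := i) (by omega)
    rw [hi] at h1
    exact hJ (J + i) (by omega) n (by omega) h1

end Drift
section EditPaths

variable {B : Type}

lemma reflTransGen_editStep (v w : List B) : Relation.ReflTransGen EditStep v w := by
  have hdel : Relation.ReflTransGen EditStep v [] := by
    induction v with
    | nil => exact .refl
    | cons a v ih => exact .head (Or.inr (Or.inr ⟨[], v, a, by simp, by simp⟩)) ih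
  refine hdel.trans ?_
  induction w with
  | nil => exact .refl
  | cons a w ih => exact .tail ih (Or.inr (Or.inl ⟨[], w, a, by simp, by simp⟩))

lemma exists_editPath (v w : List B) :
    ∃ f : ℕ → List B, f 0 = v ∧ f (editDist v w) = w ∧
      ∀ i < editDist v w, EditStep (f i) (f (i + 1)) := by
  refine Nat.sInf_mem
    (s := {n | ∃ f : ℕ → List B, f 0 = v ∧ f n = w ∧ ∀ i < n, EditStep (f i) (f (i + 1))}) ?_
  induction reflTransGen_editStep v w using Relation.ReflTransGen.head_induction_on with
  | refl => exact ⟨0, fun _ => w, rfl, rfl, by simp⟩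
  | @head u u' hs _ ih =>
    obtain ⟨n, f, h0, hn, hf⟩ := ih
    refine ⟨n + 1, fun i => match i with | 0 => u | i + 1 => f i, rfl, hn, fun i hi => ?_⟩
    cases i with
    | zero => simpa [h0] using hs
    | succ i => exact hf i (by omega)

/-- B functional which is Lipschitz for single edits is Lipschitz for the edit distance. -/
lemma abs_sub_le_mul_editDist {F : List B → ℝ} {C : ℝ}
    (hF : ∀ v w, EditStep v w → |F v - F w| ≤ C) (v w : List B) :
    |F v - F w| ≤ C * editDist v w := by
  obtain ⟨f, h0, hn, hf⟩ := exists_editPath v w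
  have key : ∀ i ≤ editDist v w, |F v - F (f i)| ≤ C * i := by
    intro i hi
    induction i with
    | zero => simp [h0]
    | succ i ih =>
      have h1 := ih (by omega)
      have h2 := hF _ _ (hf i (by omega))
      have := abs_sub_le (F v) (F (f i)) (F (f (i + 1)))
      push_cast
      linarith
  simpa [hn] using key _ le_rfl

lemma abs_length_sub_le_editDist (v w : List B) :
    |(v.length : ℝ) - w.length| ≤ editDist v w := by
  have := abs_sub_le_mul_editDist (F := fun l : List B => (l.length : ℝ)) (C := 1) ?_ v w
  · simpa using this
  · rintro _ _ (⟨u₁, u₂, a, a', rfl, rfl⟩ | ⟨u₁, u₂, a', rfl, rfl⟩ | ⟨u₁, u₂, a, rfl, rfl⟩) <;>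
      simp only [List.length_append, List.length_cons, List.length_nil] <;> push_cast <;>
      rw [abs_le] <;> constructor <;> linarith

end EditPaths

section WindowSum

variable {B : Type}

/-- The sum of a function of words over all windows of length `k` of a word, the windows being
truncated at the end of the word. -/
def windowSum (P : List B → ℝ) (k : ℕ) : List B → ℝ
  | [] => 0
  | a :: w => P ((a :: w).take k) + windowSum P k w

variable {P : List B → ℝ} {M : ℝ}

lemma abs_windowSum_le (hP : ∀ w, |P w| ≤ M) (k : ℕ) (w : List B) :
    |windowSum P k w| ≤ M * w.length := by
  induction w with
  | nil => simp [windowSum]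
  | cons a w ih =>
    have h := hP ((a :: w).take k)
    rw [windowSum]
    refine (abs_add_le _ _).trans ?_
    push_cast [List.length_cons]
    linarith

lemma abs_windowSum_append_sub_le (hP : ∀ w, |P w| ≤ M) (k : ℕ) (u v : List B) :
    |windowSum P k (u ++ v) - windowSum P k u - windowSum P k v| ≤ 2 * M * k := by
  have hM : 0 ≤ M := (abs_nonneg _).trans (hP [])
  suffices h : |windowSum P k (u ++ v) - windowSum P k u - windowSum P k v| ≤
      2 * M * (min k u.length : ℕ) by
    refine h.trans (mul_le_mul_of_nonneg_left ?_ (by positivity))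
    exact_mod_cast min_le_left _ _
  induction u with
  | nil => simp [windowSum]
  | cons a u ih =>
    rw [List.cons_append, windowSum, windowSum, ← List.cons_append]
    rcases le_or_gt k (a :: u).length with hk | hk
    · rw [List.take_append_of_le_length hk]
      have hmono : 2 * M * (min k u.length : ℕ) ≤ 2 * M * (min k (a :: u).length : ℕ) := by
        refine mul_le_mul_of_nonneg_left ?_ (by positivity)
        exact_mod_cast min_le_min_left _ (by simp)
      refine le_trans (le_of_eq ?_) (ih.trans hmono)
      congr 1
      ring
    · have h1 := abs_le.1 (hP (((a :: u) ++ v).take k))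
      have h2 := abs_le.1 (hP ((a :: u).take k))
      rw [List.length_cons] at hk
      rw [min_eq_right (by omega)] at ih
      rw [List.length_cons, min_eq_right hk.le]
      push_cast
      rw [abs_le] at ih ⊢
      constructor <;> linarith

lemma abs_windowSum_sub_le_of_editStep (hP : ∀ w, |P w| ≤ M) (k : ℕ) {v w : List B}
    (h : EditStep v w) : |windowSum P k v - windowSum P k w| ≤ 8 * M * k + 2 * M := by
  have hM : 0 ≤ M := (abs_nonneg _).trans (hP [])
  have hk : 0 ≤ M * k := by positivity
  have h1 : ∀ u v, _ ∧ _ := fun u v => abs_le.1 (abs_windowSum_append_sub_le hP k u v)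
  have h2 : ∀ a, _ ∧ _ := fun a : B => abs_le.1 (abs_windowSum_le hP k [a])
  simp only [List.length_singleton, Nat.cast_one, mul_one] at h2
  rw [abs_le]
  rcases h with ⟨u₁, u₂, a, a', rfl, rfl⟩ | ⟨u₁, u₂, a', rfl, rfl⟩ | ⟨u₁, u₂, a, rfl, rfl⟩
  · have := h1 u₁ [a]; have := h1 (u₁ ++ [a]) u₂
    have := h1 u₁ [a']; have := h1 (u₁ ++ [a']) u₂
    have := h2 a; have := h2 a'
    constructor <;> linarith
  · have := h1 u₁ u₂
    have := h1 u₁ [a']; have := h1 (u₁ ++ [a']) u₂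
    have := h2 a'
    constructor <;> linarith
  · have := h1 u₁ u₂
    have := h1 u₁ [a]; have := h1 (u₁ ++ [a]) u₂
    have := h2 a
    constructor <;> linarith

end WindowSum

section Words

variable {B : Type}

lemma length_prefixWord (x : ℕ → B) (n : ℕ) : (prefixWord x n).length = n := by
  simp [prefixWord]

lemma prefixWord_succ (x : ℕ → B) (n : ℕ) :
    prefixWord x (n + 1) = x 0 :: prefixWord (shift x) n := by
  simp [prefixWord, List.ofFn_succ, shift]

lemma take_prefixWord (x : ℕ → B) (n k : ℕ) :
    (prefixWord x n).take k = prefixWord x (min k n) := by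
  apply List.ext_getElem <;> simp [prefixWord]

lemma prefixWord_eq_iff {x y : ℕ → B} {n : ℕ} :
    prefixWord x n = prefixWord y n ↔ ∀ i < n, x i = y i := by
  simp only [prefixWord, List.ofFn_inj, funext_iff]
  exact ⟨fun h i hi => h ⟨i, hi⟩, fun h i => h i i.2⟩

lemma mem_cylinder_iff {x : ℕ → B} {w : List B} :
    x ∈ cylinder w ↔ prefixWord x w.length = w := by
  conv_rhs => rhs; rw [← List.ofFn_get w]
  simp only [prefixWord, cylinder, List.ofFn_inj, funext_iff, mem_ofPred_eq]

lemma prefixWord_mem_language {X : Set (ℕ → B)} {x : ℕ → B} (hx : x ∈ X) (n : ℕ) :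
    prefixWord x n ∈ language X :=
  ⟨x, mem_cylinder_iff.2 (by rw [length_prefixWord]), hx⟩

lemma isClosed_cylinder [TopologicalSpace B] [DiscreteTopology B] (w : List B) :
    IsClosed (cylinder w) := by
  have : cylinder w = ⋂ i : Fin w.length, {x : ℕ → B | x i = w.get i} := by
    ext x; simp [cylinder]
  rw [this]
  exact isClosed_iInter fun i => isClosed_eq (continuous_apply _) continuous_const

lemma cylinder_append_subset (u v : List B) : cylinder (u ++ v) ⊆ cylinder u := by
  intro x hx
  rw [mem_cylinder_iff] at hx ⊢
  have := congrArg (List.take u.length) hx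
  rwa [take_prefixWord, List.length_append, min_eq_left (by omega), List.take_left] at this

end Words

section Potential

variable {B : Type} {X : Set (ℕ → B)}

lemma compactSpace_of_isClosed [Finite B] [TopologicalSpace B] (hX : IsClosed X) :
    CompactSpace ↥X :=
  isCompact_iff_compactSpace.1 hX.isCompact

lemma exists_forall_abs_sub_le_of_prefix [Finite B] [TopologicalSpace B] [DiscreteTopology B]
    (hX : IsClosed X) {ψ : ↥X → ℝ}
    (hψ : Continuous ψ) {ε : ℝ} (hε : 0 < ε) :
    ∃ k, ∀ x y : ↥X, prefixWord x.val k = prefixWord y.val k → |ψ x - ψ y| ≤ ε := by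
  let : MetricSpace (ℕ → B) := PiNat.metricSpace
  have := compactSpace_of_isClosed hX
  obtain ⟨δ, hδ, h⟩ := Metric.uniformContinuous_iff.1
    (CompactSpace.uniformContinuous_of_continuous hψ) ε hε
  obtain ⟨k, hk⟩ := exists_pow_lt_of_lt_one hδ (by norm_num : (1 / 2 : ℝ) < 1)
  refine ⟨k, fun x y hxy => (h ?_).le⟩
  refine lt_of_le_of_lt ?_ hk
  exact PiNat.mem_cylinder_iff_dist_le.1 (PiNat.mem_cylinder_iff.2 (prefixWord_eq_iff.1 hxy))

/-- B function of words agreeing with `ψ` at some point of the cylinder. -/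
noncomputable def sampleWord (ψ : ↥X → ℝ) (w : List B) : ℝ :=
  if h : ∃ x : ↥X, prefixWord x.val w.length = w then ψ h.choose else 0

lemma abs_sampleWord_le {ψ : ↥X → ℝ} {M : ℝ} (hM : 0 ≤ M)
    (hψ : ∀ x, |ψ x| ≤ M) (w : List B) : |sampleWord ψ w| ≤ M := by
  unfold sampleWord
  split_ifs with h
  · exact hψ _
  · simpa using hM

lemma abs_sub_sampleWord_le {ψ : ↥X → ℝ} {ε : ℝ} {k : ℕ}
    (hk : ∀ x y : ↥X, prefixWord x.val k = prefixWord y.val k → |ψ x - ψ y| ≤ ε) (x : ↥X) :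
    |ψ x - sampleWord ψ (prefixWord x.val k)| ≤ ε := by
  have h : ∃ y : ↥X, prefixWord y.val (prefixWord x.val k).length = prefixWord x.val k :=
    ⟨x, by rw [length_prefixWord]⟩
  rw [sampleWord, dif_pos h]
  refine hk _ _ ?_
  simpa only [length_prefixWord] using h.choose_spec.symm

lemma subShift_val (hX : MapsTo shift X X) (x : ↥X) :
    (subShift X x).val = shift x.val := by
  rw [subShift, dif_pos (hX x.2)]

lemma continuous_subShift [TopologicalSpace B] (hX : MapsTo shift X X) :
    Continuous (subShift X) := by
  rw [continuous_induced_rng]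
  have : Subtype.val ∘ subShift X = shift ∘ Subtype.val := funext fun x => subShift_val hX x
  rw [this]
  refine Continuous.comp ?_ continuous_subtype_val
  exact continuous_pi fun i => continuous_apply (i + 1)

lemma abs_birkhoff_sub_windowSum_le (hX : MapsTo shift X X) {ψ : ↥X → ℝ}
    {M : ℝ} (hM : 0 ≤ M) (hψ : ∀ x, |ψ x| ≤ M) {ε : ℝ} (hε : 0 ≤ ε) {k : ℕ}
    (hk : ∀ x y : ↥X, prefixWord x.val k = prefixWord y.val k → |ψ x - ψ y| ≤ ε)
    (n : ℕ) (x : ↥X) :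
    |birkhoff (subShift X) ψ n x - windowSum (sampleWord ψ) k (prefixWord x.val n)| ≤
      ε * n + 2 * M * k := by
  suffices h : |birkhoff (subShift X) ψ n x -
      windowSum (sampleWord ψ) k (prefixWord x.val n)| ≤ ε * n + 2 * M * (min k n : ℕ) by
    have : ((min k n : ℕ) : ℝ) ≤ k := by exact_mod_cast min_le_left _ _
    nlinarith
  induction n generalizing x with
  | zero => simp [birkhoff, prefixWord, windowSum]
  | succ n ih =>
    have ih := abs_le.1 (ih (subShift X x))
    rw [subShift_val hX] at ih
    rw [birkhoff_succ, prefixWord_succ, windowSum, ← prefixWord_succ, take_prefixWord]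
    push_cast
    rcases le_or_gt k (n + 1) with h | h
    · rw [min_eq_left h]
      have h1 := abs_le.1 (abs_sub_sampleWord_le hk x)
      have h2 : ((min k n : ℕ) : ℝ) ≤ k := by exact_mod_cast min_le_left _ _
      have h3 : 2 * M * (min k n : ℕ) ≤ 2 * M * k :=
        mul_le_mul_of_nonneg_left h2 (by positivity)
      have h4 : min (k : ℝ) (n + 1) = k := min_eq_left (by exact_mod_cast h)
      rw [abs_le, h4]
      constructor <;> linarith
    · have h1 := abs_le.1 (hψ x)
      have h2 := abs_le.1 (abs_sampleWord_le hM hψ (prefixWord x.val (min k (n + 1))))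
      rw [min_eq_right (by omega : n ≤ k)] at ih
      have h4 : min (k : ℝ) (n + 1) = n + 1 := min_eq_right (by exact_mod_cast h.le)
      rw [abs_le, h4]
      constructor <;> linarith

lemma abs_birkhoff_sub_birkhoff_le {Y : Type*} (σ : Y → Y) {ψ : Y → ℝ} {M : ℝ}
    (hψ : ∀ x, |ψ x| ≤ M) {m n : ℕ} (hmn : m ≤ n) (x : Y) :
    |birkhoff σ ψ n x - birkhoff σ ψ m x| ≤ M * (n - m) := by
  induction n, hmn using Nat.le_induction with
  | base => simp
  | succ n hn ih =>
    have h1 := abs_le.1 (hψ (σ^[n] x))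
    rw [abs_le] at ih ⊢
    rw [birkhoff_succ_last]
    push_cast
    constructor <;> linarith

end Potential

section Concatenation

variable {B : Type} {X : Set (ℕ → B)} {G : Set (List B)} {ψ : ↥X → ℝ} {M ε : ℝ} {k : ℕ}

lemma MistakeFun.eventually_le {g : ℕ → ℕ} (hg : MistakeFun g) {δ : ℝ} (hδ : 0 < δ) :
    ∀ᶠ n : ℕ in atTop, (g n : ℝ) ≤ δ * n := by
  filter_upwards [hg.2.eventually_le_const hδ, eventually_gt_atTop 0] with n hn h0
  rwa [div_le_iff₀ (by exact_mod_cast h0)] at hn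

lemma eventually_length_of_editDist_le {g : ℕ → ℕ} (hg : MistakeFun g) {x : ℕ → ↥X}
    {v : ℕ → List B} (hv : ∀ n, editDist (v n) (prefixWord (x n).val n) ≤ g n) :
    ∀ᶠ n : ℕ in atTop, (n : ℝ) / 2 ≤ (v n).length ∧ ((v n).length : ℝ) ≤ 2 * n := by
  filter_upwards [hg.eventually_le (by norm_num : (0 : ℝ) < 1 / 2)] with n hn
  have h1 := abs_length_sub_le_editDist (v n) (prefixWord (x n).val n)
  have h2 : (editDist (v n) (prefixWord (x n).val n) : ℝ) ≤ g n := by exact_mod_cast hv n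
  rw [length_prefixWord, abs_le] at h1
  have : (0 : ℝ) ≤ n := by positivity
  constructor <;> linarith

lemma eventually_abs_windowSum_sub_birkhoff_le (hX : MapsTo shift X X) (hM : 0 ≤ M)
    (hψ : ∀ x, |ψ x| ≤ M) (hε : 0 < ε)
    (hk : ∀ x y : ↥X, prefixWord x.val k = prefixWord y.val k → |ψ x - ψ y| ≤ ε)
    {g : ℕ → ℕ} (hg : MistakeFun g) {x : ℕ → ↥X} {v : ℕ → List B}
    (hv : ∀ n, editDist (v n) (prefixWord (x n).val n) ≤ g n) :
    ∀ᶠ n : ℕ in atTop, |windowSum (sampleWord ψ) k (v n) - birkhoff (subShift X) ψ n (x n)| ≤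
      4 * ε * (v n).length := by
  set C := 8 * M * k + 2 * M with hC
  have hC0 : 0 ≤ C := by positivity
  have hδ : 0 < ε / 2 / (C + 1) := by positivity
  filter_upwards [hg.eventually_le hδ, eventually_length_of_editDist_le hg hv,
    tendsto_natCast_atTop_atTop.eventually_ge_atTop (2 * (2 * M * k) / ε)] with n h1 h2 h3
  have hed : (editDist (v n) (prefixWord (x n).val n) : ℝ) ≤ g n := by exact_mod_cast hv n
  have h4 := abs_sub_le_mul_editDist (F := windowSum (sampleWord ψ) k)
    (fun _ _ h => abs_windowSum_sub_le_of_editStep (abs_sampleWord_le hM hψ) k h)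
    (v n) (prefixWord (x n).val n)
  have h5 := abs_birkhoff_sub_windowSum_le hX hM hψ hε.le hk n (x n)
  rw [div_le_iff₀ hε] at h3
  have h6 : C * g n ≤ ε / 2 * n := by
    calc C * g n ≤ (C + 1) * g n := by gcongr; linarith
      _ ≤ (C + 1) * (ε / 2 / (C + 1) * n) := by gcongr
      _ = ε / 2 * n := by field_simp
  have h7 := mul_le_mul_of_nonneg_left hed hC0
  have h8 := mul_le_mul_of_nonneg_left h2.1 hε.le
  rw [← hC] at h4
  rw [abs_le] at h4 h5 ⊢
  constructor <;> linarith

/-- Greedy concatenation of words of `G`: at each stage the next word is taken from `vm` or `vp`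
according to the sign of a Birkhoff sum along the word built so far. -/
lemma exists_greedy_concatenation {L : Set (List B)} (hG : G ⊆ language X) {τ : ℕ}
    (hτ : ∀ v ∈ G, ∀ w ∈ G, ∃ u ∈ L, u.length ≤ τ ∧ v ++ u ++ w ∈ G)
    (S : ℕ → ↥X → ℝ) {vp vm : ℕ → List B} (hvp : ∀ n, vp n ∈ G) (hvm : ∀ n, vm n ∈ G) :
    ∃ W : ℕ → List B, (∀ j, W j ∈ G) ∧ ∀ j, ∃ u v : List B, W (j + 1) = W j ++ (u ++ v) ∧
      u.length ≤ τ ∧ ∃ x : ↥X, prefixWord x.val (W j).length = W j ∧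
        (0 ≤ S (W j).length x ∧ v = vm j ∨ S (W j).length x ≤ 0 ∧ v = vp j) := by
  have step : ∀ (j : ℕ) (w : G), ∃ w' : G, ∃ u v : List B, w'.1 = w.1 ++ (u ++ v) ∧
      u.length ≤ τ ∧ ∃ x : ↥X, prefixWord x.val w.1.length = w.1 ∧
        (0 ≤ S w.1.length x ∧ v = vm j ∨ S w.1.length x ≤ 0 ∧ v = vp j) := by
    rintro j ⟨w, hw⟩
    obtain ⟨x, hxw, hx⟩ := hG hw
    rw [mem_cylinder_iff] at hxw
    rcases le_total 0 (S w.length ⟨x, hx⟩) with h | h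
    · obtain ⟨u, -, hu, huG⟩ := hτ w hw (vm j) (hvm j)
      exact ⟨⟨_, huG⟩, u, vm j, List.append_assoc _ _ _, hu, ⟨x, hx⟩, hxw, Or.inl ⟨h, rfl⟩⟩
    · obtain ⟨u, -, hu, huG⟩ := hτ w hw (vp j) (hvp j)
      exact ⟨⟨_, huG⟩, u, vp j, List.append_assoc _ _ _, hu, ⟨x, hx⟩, hxw, Or.inr ⟨h, rfl⟩⟩
  choose next hnext using step
  let W : ℕ → G := fun n => Nat.rec ⟨vp 0, hvp 0⟩ next n
  exact ⟨fun j => (W j).1, fun j => (W j).2, fun j => hnext j (W j)⟩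

lemma exists_point_of_nested_words [Finite B] [TopologicalSpace B] [DiscreteTopology B]
    (hX : IsClosed X) {W : ℕ → List B}
    (hW : ∀ j, W j ∈ language X) (hnest : ∀ j, ∃ u, W (j + 1) = W j ++ u) :
    ∃ x : ↥X, ∀ j, prefixWord x.val (W j).length = W j := by
  obtain ⟨x, hx⟩ := IsCompact.nonempty_iInter_of_sequence_nonempty_isCompact_isClosed
    (fun j => cylinder (W j) ∩ X)
    (fun j => by
      obtain ⟨u, hu⟩ := hnest j
      rw [hu]
      exact inter_subset_inter_left _ (cylinder_append_subset _ _))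
    hW ((isClosed_cylinder _).inter hX).isCompact
    (fun j => (isClosed_cylinder _).inter hX)
  rw [mem_iInter] at hx
  exact ⟨⟨x, (hx 0).2⟩, fun j => mem_cylinder_iff.1 (hx j).1⟩

lemma exists_tendsto_birkAvg_zero [Finite B] [TopologicalSpace B] [DiscreteTopology B]
    (hXcl : IsClosed X) (hX : MapsTo shift X X) (hG : G ⊆ language X)
    (hspec : HasSpecW (language X) G) (happ : EditApproachable (language X) G)
    (hψ : Continuous ψ) (hp : ∀ n, ∃ x, 0 ≤ birkhoff (subShift X) ψ n x)
    (hm : ∀ n, ∃ x, birkhoff (subShift X) ψ n x ≤ 0) :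
    ∃ x, Tendsto (fun n => birkAvg (subShift X) ψ n x) atTop (𝓝 0) := by
  have := compactSpace_of_isClosed hXcl
  obtain ⟨M, hM, hbd⟩ : ∃ M : ℝ, 0 ≤ M ∧ ∀ x, |ψ x| ≤ M :=
    ⟨‖BoundedContinuousFunction.mkOfCompact ⟨ψ, hψ⟩‖, norm_nonneg _,
      (BoundedContinuousFunction.mkOfCompact ⟨ψ, hψ⟩).norm_coe_le_norm⟩
  obtain ⟨τ, hτ⟩ := hspec
  obtain ⟨g, hg, happ⟩ := happ
  choose xp hxp using hp
  choose xm hxm using hm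
  choose vp hvpG hvp using fun n => happ _ (prefixWord_mem_language (xp n).2 n)
  choose vm hvmG hvm using fun n => happ _ (prefixWord_mem_language (xm n).2 n)
  simp only [length_prefixWord] at hvp hvm
  obtain ⟨W, hWG, hW⟩ := exists_greedy_concatenation hG hτ (birkhoff (subShift X) ψ) hvpG hvmG
  obtain ⟨x, hx⟩ := exists_point_of_nested_words hXcl (fun j => hG (hWG j))
    (fun j => let ⟨u, v, h, _⟩ := hW j; ⟨u ++ v, h⟩)
  refine ⟨x, ?_⟩
  have hlen : ∀ᶠ j : ℕ in atTop, ∀ u v : List B, W (j + 1) = W j ++ (u ++ v) →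
      (v = vm j ∨ v = vp j) → ((W (j + 1)).length : ℝ) = (W j).length + u.length + v.length ∧
        (j : ℝ) / 2 ≤ v.length ∧ (v.length : ℝ) ≤ 2 * j := by
    filter_upwards [eventually_length_of_editDist_le hg hvp,
      eventually_length_of_editDist_le hg hvm] with j h1 h2 u v huv hv
    refine ⟨by rw [huv]; push_cast [List.length_append]; ring, ?_⟩
    rcases hv with rfl | rfl
    exacts [h2, h1]
  have hgrow : ∀ K : ℝ, ∀ᶠ j : ℕ in atTop, K * j ≤ (W j).length := by
    refine eventually_mul_le_of_increment ?_
    filter_upwards [hlen] with j hj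
    obtain ⟨u, v, huv, -, y, -, hv⟩ := hW j
    obtain ⟨h1, h2, -⟩ := hj u v huv (hv.imp And.right And.right)
    have : (0 : ℝ) ≤ u.length := by positivity
    linarith
  have hℓ : Tendsto (fun j => ((W j).length : ℝ)) atTop atTop :=
    tendsto_atTop_mono' _ ((hgrow 1).mono fun j hj => by simpa using hj) tendsto_natCast_atTop_atTop
  rw [Metric.tendsto_atTop']
  intro ε₀ hε₀
  obtain ⟨ε, hε, hεε₀⟩ : ∃ ε, 0 < ε ∧ 12 * ε < ε₀ := ⟨ε₀ / 13, by positivity, by linarith⟩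
  obtain ⟨k, hk⟩ := exists_forall_abs_sub_le_of_prefix hXcl hψ hε
  set Φ := windowSum (sampleWord ψ) k
  set D := 2 * M * k with hD
  set E := 2 * D + M * τ with hE
  have hD0 : 0 ≤ D := by positivity
  have hP := abs_sampleWord_le hM hbd
  -- one step of the concatenation, up to the error `E`
  have hstep : ∀ w u v : List B, u.length ≤ τ → |Φ (w ++ (u ++ v)) - Φ w - Φ v| ≤ E := by
    intro w u v hu
    have h1 := abs_le.1 (abs_windowSum_append_sub_le hP k w (u ++ v))
    have h2 := abs_le.1 (abs_windowSum_append_sub_le hP k u v)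
    have h3 := abs_le.1 (abs_windowSum_le hP k u)
    have h4 : M * u.length ≤ M * τ := by gcongr
    rw [abs_le]
    constructor <;> linarith
  have hsmall : ∀ᶠ j : ℕ in atTop, D + E + M * (2 * j) ≤ ε * (W j).length := by
    filter_upwards [hgrow ((D + E + 2 * M) / ε), eventually_ge_atTop 1] with j h1 h2
    have h3 : (1 : ℝ) ≤ j := by exact_mod_cast h2
    rw [div_mul_eq_mul_div, div_le_iff₀ hε] at h1
    have hE0 : 0 ≤ E := by positivity
    nlinarith
  have hEv : ∀ᶠ j : ℕ in atTop, E ≤ ε * (j / 2) := by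
    filter_upwards [tendsto_natCast_atTop_atTop.eventually_ge_atTop (2 * E / ε)] with j hj
    rw [div_le_iff₀ hε] at hj
    linarith
  have hdrift : ∀ᶠ j : ℕ in atTop,
      (Φ (W (j + 1)) ≤ Φ (W j) + 5 * ε * ((W (j + 1)).length - (W j).length) ∨
        Φ (W (j + 1)) ≤ 5 * ε * (W (j + 1)).length) ∧
      (-Φ (W (j + 1)) ≤ -Φ (W j) + 5 * ε * ((W (j + 1)).length - (W j).length) ∨
        -Φ (W (j + 1)) ≤ 5 * ε * (W (j + 1)).length) := by
    filter_upwards [hlen, hsmall, hEv,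
      eventually_abs_windowSum_sub_birkhoff_le hX hM hbd hε hk hg hvp,
      eventually_abs_windowSum_sub_birkhoff_le hX hM hbd hε hk hg hvm] with j h1 h2 h3 h4 h5
    obtain ⟨u, v, huv, hu, y, hy, hv⟩ := hW j
    obtain ⟨h6, h7, h8⟩ := h1 u v huv (hv.imp And.right And.right)
    have h9 := abs_le.1 (hstep (W j) u v hu)
    rw [← huv] at h9
    have h10 := abs_birkhoff_sub_windowSum_le hX hM hbd hε.le hk (W j).length y
    rw [hy, abs_le] at h10
    have h11 := abs_le.1 (abs_windowSum_le hP k v)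
    have h12 := mul_le_mul_of_nonneg_left h7 hε.le
    have h13 := mul_le_mul_of_nonneg_left h8 hM
    have h14 : 0 ≤ ε * u.length := by positivity
    have h15 : 0 ≤ ε * v.length := by positivity
    have h16 : 0 ≤ ε * (W j).length := by positivity
    rw [h6]
    rcases hv with ⟨hs, rfl⟩ | ⟨hs, rfl⟩
    · have h17 := abs_le.1 h5
      have h18 := hxm j
      exact ⟨Or.inl (by linarith), Or.inr (by linarith)⟩
    · have h17 := abs_le.1 h4
      have h18 := hxp j
      exact ⟨Or.inr (by linarith), Or.inl (by linarith)⟩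
  have hup := eventually_le_of_drift (t := fun j => Φ (W j)) (ε := 5 * ε) (by positivity) hℓ
    (hdrift.mono fun _ h => h.1)
  have hlow := eventually_le_of_drift (t := fun j => -Φ (W j)) (ε := 5 * ε) (by positivity) hℓ
    (hdrift.mono fun _ h => h.2)
  have hsum : ∀ᶠ n : ℕ in atTop, |birkhoff (subShift X) ψ n x| ≤ 12 * ε * n := by
    refine eventually_of_blocks (tendsto_natCast_atTop_iff.1 hℓ) ?_
    filter_upwards [hlen, hsmall, hup, hlow] with j h1 h2 h3 h4 n hn hn'
    obtain ⟨u, v, huv, hu, y, -, hv⟩ := hW j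
    obtain ⟨h6, -, h8⟩ := h1 u v huv (hv.imp And.right And.right)
    have h9 := abs_birkhoff_sub_windowSum_le hX hM hbd hε.le hk (W j).length x
    rw [hx, abs_le] at h9
    have h10 := abs_le.1 (abs_birkhoff_sub_birkhoff_le (subShift X) hbd hn x)
    have hn1 : ((W j).length : ℝ) ≤ n := by exact_mod_cast hn
    have hn2 : (n : ℝ) ≤ (W (j + 1)).length := by exact_mod_cast hn'
    have hu' : (u.length : ℝ) ≤ τ := by exact_mod_cast hu
    have h11 : M * (n - (W j).length) ≤ M * (τ + 2 * j) :=
      mul_le_mul_of_nonneg_left (by linarith) hM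
    have h12 := mul_le_mul_of_nonneg_left hn1 hε.le
    rw [abs_le]
    constructor <;> linarith
  obtain ⟨N, hN⟩ := eventually_atTop.1 hsum
  refine ⟨N, fun n hn => ?_⟩
  have hn0 : (0 : ℝ) < n := by exact_mod_cast (Nat.zero_le N).trans_lt hn
  rw [Real.dist_eq, sub_zero, birkAvg, abs_mul, abs_of_pos (inv_pos.2 hn0), inv_mul_lt_iff₀ hn0]
  have h2 := mul_lt_mul_of_pos_right hεε₀ hn0
  linarith [hN n hn.le]

/-- If the Birkhoff sums of `ψ` of every length are somewhere at least and somewhere at most those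
of the constant `α`, then the level set of `α` is nonempty. -/
lemma levelSet_nonempty [Finite B] [TopologicalSpace B] [DiscreteTopology B]
    (hXcl : IsClosed X) (hX : MapsTo shift X X) (hG : G ⊆ language X)
    (hspec : HasSpecW (language X) G) (happ : EditApproachable (language X) G)
    (hψ : Continuous ψ) {α : ℝ} (hp : ∀ n : ℕ, ∃ x, n * α ≤ birkhoff (subShift X) ψ n x)
    (hm : ∀ n : ℕ, ∃ x, birkhoff (subShift X) ψ n x ≤ n * α) :
    (levelSet (subShift X) ψ α).Nonempty := by
  have hsub : ∀ (n : ℕ) (x : ↥X), birkhoff (subShift X) (fun y => ψ y - α) n x =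
      birkhoff (subShift X) ψ n x - n * α := fun n x => by
    simp [birkhoff, Finset.sum_sub_distrib]
  obtain ⟨x, hx⟩ := exists_tendsto_birkAvg_zero (ψ := fun y => ψ y - α) hXcl hX hG hspec happ
    (hψ.sub continuous_const)
    (fun n => (hp n).imp fun x h => by rw [hsub]; linarith)
    (fun n => (hm n).imp fun x h => by rw [hsub]; linarith)
  refine ⟨x, ?_⟩
  have h := hx.add_const α
  rw [zero_add] at h
  refine h.congr' ?_
  filter_upwards [eventually_ne_atTop 0] with n hn
  have : (n : ℝ) ≠ 0 := by exact_mod_cast hn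
  rw [birkAvg, birkAvg, hsub]
  field_simp
  ring

end Concatenation

/-- the multifractal spectrum is a non-empty bounded interval, equal to the
set of integrals of `ψ` against invariant measures. -/
theorem statement_11 {A : Type} [Fintype A] [DecidableEq A] [TopologicalSpace A]
    [DiscreteTopology A] [MeasurableSpace A] [BorelSpace A]
    (X : Set (ℕ → A)) (hXcl : IsClosed X) (hXinv : Set.MapsTo shift X X)
    (hXne : X.Nonempty)
    (G : Set (List A)) (hG : G ⊆ language X)
    (hspec : HasSpecW (language X) G) (happ : EditApproachable (language X) G)
    (ψ : ↥X → ℝ) (hψ : Continuous ψ) :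
    ({α : ℝ | (levelSet (subShift X) ψ α).Nonempty}).Nonempty ∧
    BddAbove {α : ℝ | (levelSet (subShift X) ψ α).Nonempty} ∧
    BddBelow {α : ℝ | (levelSet (subShift X) ψ α).Nonempty} ∧
    OrdConnected {α : ℝ | (levelSet (subShift X) ψ α).Nonempty} ∧
    {α : ℝ | (levelSet (subShift X) ψ α).Nonempty} =
      {α : ℝ | ∃ μ : ProbabilityMeasure ↥X, IsInvariant (subShift X) μ ∧
        (∫ x, ψ x ∂μ.toMeasure) = α} := by
  have := compactSpace_of_isClosed hXcl
  have hσ := continuous_subShift hXinv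
  have hint : ∀ μ : ProbabilityMeasure ↥X, Integrable ψ μ.toMeasure := fun μ =>
    (BoundedContinuousFunction.mkOfCompact ⟨ψ, hψ⟩).integrable _
  have hge : ∀ μ : ProbabilityMeasure ↥X, IsInvariant (subShift X) μ → ∀ n : ℕ,
      ∃ x, n * ∫ y, ψ y ∂μ.toMeasure ≤ birkhoff (subShift X) ψ n x := fun μ hμ n => by
    obtain ⟨h1, h2⟩ := integral_birkhoff hσ.measurable hμ (hint μ) n
    rw [← h2]
    exact exists_integral_le h1
  have hle : ∀ μ : ProbabilityMeasure ↥X, IsInvariant (subShift X) μ → ∀ n : ℕ,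
      ∃ x, birkhoff (subShift X) ψ n x ≤ n * ∫ y, ψ y ∂μ.toMeasure := fun μ hμ n => by
    obtain ⟨h1, h2⟩ := integral_birkhoff hσ.measurable hμ (hint μ) n
    rw [← h2]
    exact exists_le_integral h1
  have heq : {α : ℝ | (levelSet (subShift X) ψ α).Nonempty} =
      {α : ℝ | ∃ μ : ProbabilityMeasure ↥X, IsInvariant (subShift X) μ ∧
        (∫ x, ψ x ∂μ.toMeasure) = α} := by
    ext α
    constructor
    · rintro ⟨x, hx⟩
      obtain ⟨μ, hμ, h⟩ := exists_isInvariant_integral_eq hσ hψ x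
      exact ⟨μ, hμ, h α hx⟩
    · rintro ⟨μ, hμ, rfl⟩
      exact levelSet_nonempty hXcl hXinv hG hspec happ hψ (hge μ hμ) (hle μ hμ)
  have hbd : ∀ μ : ProbabilityMeasure ↥X, |∫ x, ψ x ∂μ.toMeasure| ≤
      ‖BoundedContinuousFunction.mkOfCompact ⟨ψ, hψ⟩‖ := fun μ =>
    (BoundedContinuousFunction.mkOfCompact ⟨ψ, hψ⟩).norm_integral_le_norm μ.toMeasure
  rw [heq]
  refine ⟨?_, ?_, ?_, ?_, rfl⟩
  · obtain ⟨x, hx⟩ := hXne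
    obtain ⟨μ, hμ, -⟩ := exists_isInvariant_integral_eq hσ hψ ⟨x, hx⟩
    exact ⟨_, μ, hμ, rfl⟩
  · refine ⟨‖BoundedContinuousFunction.mkOfCompact ⟨ψ, hψ⟩‖, ?_⟩
    rintro _ ⟨μ, -, rfl⟩
    exact (abs_le.1 (hbd μ)).2
  · refine ⟨-‖BoundedContinuousFunction.mkOfCompact ⟨ψ, hψ⟩‖, ?_⟩
    rintro _ ⟨μ, -, rfl⟩
    exact (abs_le.1 (hbd μ)).1
  · rw [← heq, ordConnected_def]
    intro a ha b hb α hα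
    rw [heq] at ha hb
    obtain ⟨μ, hμ, rfl⟩ := ha
    obtain ⟨ν, hν, rfl⟩ := hb
    refine levelSet_nonempty hXcl hXinv hG hspec happ hψ (fun n => ?_) (fun n => ?_)
    · exact (hge ν hν n).imp fun x h =>
        (mul_le_mul_of_nonneg_left hα.2 (Nat.cast_nonneg n)).trans h
    · exact (hle μ hμ n).imp fun x h =>
        h.trans (mul_le_mul_of_nonneg_left hα.1 (Nat.cast_nonneg n))

end Paper
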